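/- arXiv:1204.6583 — 5 statements merged into one kernel-verified Lean document; each statement's English description precedes it below -/
import Mathlib

section
/- Let X be a measurable space and P a probability measure on X × {+1,−1} with marginal P_X on X, and let η : X → [0,1] be a measurable function such that P(A × {+1}) = ∫_A η dP_X for every measurable A ⊆ X (a conditional probability of the label +1 given x). Suppose there exists ε > 0 such that P_X({x ∈ X : ε ≤ η(x) ≤ 1−ε}) > 0. Let ℓ : ℝ → ℝ be a convex, non-decreasing, nonnegative function whose subdifferential tends to infinity. Define, for each measurable f : X → ℝ and ρ ∈ ℝ, the expected loss R(f,ρ) = −2ρ + ∫ ℓ(ρ − y f(x)) dP(x,y) (the integral is well defined in [0,∞] since ℓ ≥ 0). Then R* := inf{ R(f,ρ) : f measurable, ρ ∈ ℝ } > −∞. -/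
open MeasureTheory
open scoped ENNReal

/-- `g` is a subgradient of `ℓ : ℝ → ℝ` at `z`. -/
def IsSubgradientAt (ℓ : ℝ → ℝ) (g z : ℝ) : Prop :=
  ∀ u, ℓ z + g * (u - z) ≤ ℓ u

/-- The subdifferential of `ℓ` tends to infinity. -/
def SubdiffTendstoInfty (ℓ : ℝ → ℝ) : Prop :=
  ∀ M : ℝ, 0 < M → ∃ z₀ : ℝ, ∀ z : ℝ, z₀ ≤ z → ∀ g : ℝ, IsSubgradientAt ℓ g z → M ≤ g

/-- A real convex function has a subgradient at every point. -/
theorem ConvexOn.exists_isSubgradientAt {ℓ : ℝ → ℝ} (hconv : ConvexOn ℝ Set.univ ℓ) (z : ℝ) :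
    ∃ g, IsSubgradientAt ℓ g z := by
  have hz : z ∈ interior (Set.univ : Set ℝ) := by simp
  refine ⟨derivWithin ℓ (Set.Ioi z) z, fun u => ?_⟩
  rcases lt_trichotomy u z with h | rfl | h
  · have h1 := (hconv.slope_le_leftDeriv_of_mem_interior (Set.mem_univ u) hz h).trans
      (hconv.leftDeriv_le_rightDeriv_of_mem_interior hz)
    rw [slope_def_field, div_le_iff₀ (sub_pos.2 h)] at h1
    linarith
  · simp
  · have h1 := hconv.rightDeriv_le_slope_of_mem_interior hz (Set.mem_univ u) h
    rw [slope_def_field, le_div_iff₀ (sub_pos.2 h)] at h1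
    linarith

/-- If the subdifferential of a nonnegative convex `ℓ` tends to infinity, then `c * ℓ ρ - 2 * ρ` is
bounded below for every `c > 0`. -/
theorem exists_forall_le_neg_two_mul_add {ℓ : ℝ → ℝ} (hconv : ConvexOn ℝ Set.univ ℓ)
    (hnonneg : ∀ z, 0 ≤ ℓ z) (hsub : SubdiffTendstoInfty ℓ) {c : ℝ} (hc : 0 < c) :
    ∃ b : ℝ, ∀ ρ : ℝ, b ≤ -2 * ρ + c * ℓ ρ := by
  obtain ⟨z, hz⟩ := hsub (2 / c) (by positivity)
  obtain ⟨g, hg⟩ := hconv.exists_isSubgradientAt z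
  have hgM : 2 ≤ c * g := by
    have h := hz z le_rfl g hg
    rwa [div_le_iff₀ hc, mul_comm] at h
  refine ⟨-2 * z, fun ρ => ?_⟩
  rcases le_total ρ z with h | h
  · nlinarith [mul_nonneg hc.le (hnonneg ρ)]
  · have h1 : g * (ρ - z) ≤ ℓ ρ := by linarith [hg ρ, hnonneg z]
    have h2 := mul_le_mul_of_nonneg_left h1 hc.le
    have h3 := mul_le_mul_of_nonneg_right hgM (sub_nonneg.2 h)
    linarith

section LabelledData

variable {X : Type*} [MeasurableSpace X] {P : Measure (X × ℝ)}
  {η : X → ℝ} {ε : ℝ} {A : Set X}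

theorem integrable_of_mem_Icc {μ : Measure X} [IsFiniteMeasure μ] (hη : Measurable η)
    (hη01 : ∀ x, η x ∈ Set.Icc (0 : ℝ) 1) : Integrable η μ :=
  Integrable.of_bound hη.aestronglyMeasurable 1
    (.of_forall fun x => by rw [Real.norm_of_nonneg (hη01 x).1]; exact (hη01 x).2)

theorem measureReal_prod_one (hη01 : ∀ x, η x ∈ Set.Icc (0 : ℝ) 1)
    (hcond : ∀ A : Set X, MeasurableSet A →
      P (A ×ˢ ({1} : Set ℝ)) = ENNReal.ofReal (∫ x in A, η x ∂(P.map Prod.fst)))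
    (hA : MeasurableSet A) :
    P.real (A ×ˢ ({1} : Set ℝ)) = ∫ x in A, η x ∂(P.map Prod.fst) := by
  rw [measureReal_def, hcond A hA,
    ENNReal.toReal_ofReal (integral_nonneg fun x => (hη01 x).1)]

variable [IsProbabilityMeasure P]

theorem measureReal_fst_eq_add (hlabel : ∀ᵐ p ∂P, p.2 = 1 ∨ p.2 = -1) (hA : MeasurableSet A) :
    (P.map Prod.fst).real A
      = P.real (A ×ˢ ({1} : Set ℝ)) + P.real (A ×ˢ ({-1} : Set ℝ)) := by
  rw [map_measureReal_apply measurable_fst hA, ← measureReal_union]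
  · refine measureReal_congr ?_
    filter_upwards [hlabel] with p hp
    apply propext
    change p.1 ∈ A ↔ _ ∨ _
    simp only [Set.mem_prod, Set.mem_singleton_iff]
    tauto
  · rw [Set.disjoint_left]
    rintro p ⟨-, h1⟩ ⟨-, h2⟩
    rw [Set.mem_singleton_iff] at h1 h2
    linarith
  · exact hA.prod (measurableSet_singleton _)

theorem mul_measureReal_le_prod_one (hη : Measurable η) (hη01 : ∀ x, η x ∈ Set.Icc (0 : ℝ) 1)
    (hcond : ∀ A : Set X, MeasurableSet A →
      P (A ×ˢ ({1} : Set ℝ)) = ENNReal.ofReal (∫ x in A, η x ∂(P.map Prod.fst)))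
    (hA : MeasurableSet A) (hAε : ∀ x ∈ A, ε ≤ η x) :
    ε * (P.map Prod.fst).real A ≤ P.real (A ×ˢ ({1} : Set ℝ)) := by
  have := Measure.isProbabilityMeasure_map (μ := P) measurable_fst.aemeasurable
  rw [measureReal_prod_one hη01 hcond hA, mul_comm, ← smul_eq_mul, ← setIntegral_const]
  exact setIntegral_mono_on (integrable_const _).integrableOn
    (integrable_of_mem_Icc hη hη01).integrableOn hA hAε

theorem mul_measureReal_le_prod_neg_one (hlabel : ∀ᵐ p ∂P, p.2 = 1 ∨ p.2 = -1)
    (hη : Measurable η) (hη01 : ∀ x, η x ∈ Set.Icc (0 : ℝ) 1)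
    (hcond : ∀ A : Set X, MeasurableSet A →
      P (A ×ˢ ({1} : Set ℝ)) = ENNReal.ofReal (∫ x in A, η x ∂(P.map Prod.fst)))
    (hA : MeasurableSet A) (hAε : ∀ x ∈ A, η x ≤ 1 - ε) :
    ε * (P.map Prod.fst).real A ≤ P.real (A ×ˢ ({-1} : Set ℝ)) := by
  have := Measure.isProbabilityMeasure_map (μ := P) measurable_fst.aemeasurable
  have h : P.real (A ×ˢ ({1} : Set ℝ)) ≤ (1 - ε) * (P.map Prod.fst).real A := by
    rw [measureReal_prod_one hη01 hcond hA, mul_comm, ← smul_eq_mul, ← setIntegral_const]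
    exact setIntegral_mono_on (integrable_of_mem_Icc hη hη01).integrableOn
      (integrable_const _).integrableOn hA hAε
  linarith [measureReal_fst_eq_add (A := A) hlabel hA]

/-- Whatever `f` predicts, its expected loss is at least `ℓ ρ` times the probability of an error on
the inputs with an uncertain label, which is at least `ε` times the probability of these inputs. -/
theorem ofReal_mul_le_lintegral_loss (hlabel : ∀ᵐ p ∂P, p.2 = 1 ∨ p.2 = -1)
    (hη : Measurable η) (hη01 : ∀ x, η x ∈ Set.Icc (0 : ℝ) 1)
    (hcond : ∀ A : Set X, MeasurableSet A →
      P (A ×ˢ ({1} : Set ℝ)) = ENNReal.ofReal (∫ x in A, η x ∂(P.map Prod.fst)))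
    {ℓ : ℝ → ℝ} (hmono : Monotone ℓ) (hnonneg : ∀ z, 0 ≤ ℓ z)
    {f : X → ℝ} (hf : Measurable f) (ρ : ℝ) :
    ENNReal.ofReal (ε * (P.map Prod.fst).real {x | ε ≤ η x ∧ η x ≤ 1 - ε} * ℓ ρ)
      ≤ ∫⁻ p, ENNReal.ofReal (ℓ (ρ - p.2 * f p.1)) ∂P := by
  have := Measure.isProbabilityMeasure_map (μ := P) measurable_fst.aemeasurable
  set S := {x | ε ≤ η x ∧ η x ≤ 1 - ε}
  have hS : MeasurableSet S :=
    (measurableSet_le measurable_const hη).inter (measurableSet_le hη measurable_const)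
  have hfm : MeasurableSet {x | f x ≤ 0} := measurableSet_le hf measurable_const
  set T : Set (X × ℝ) := (S ∩ {x | f x ≤ 0}) ×ˢ {1} ∪ (S \ {x | f x ≤ 0}) ×ˢ {-1}
  have hT2 : MeasurableSet ((S \ {x | f x ≤ 0}) ×ˢ ({-1} : Set ℝ)) :=
    (hS.diff hfm).prod (measurableSet_singleton _)
  have hT : MeasurableSet T := ((hS.inter hfm).prod (measurableSet_singleton _)).union hT2
  have hPT : ε * (P.map Prod.fst).real S ≤ P.real T := by
    have hdisj : Disjoint ((S ∩ {x | f x ≤ 0}) ×ˢ ({1} : Set ℝ))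
        ((S \ {x | f x ≤ 0}) ×ˢ ({-1} : Set ℝ)) := by
      rw [Set.disjoint_left]
      rintro p ⟨h1, -⟩ ⟨h2, -⟩
      exact h2.2 h1.2
    rw [measureReal_union hdisj hT2, ← measureReal_inter_add_sdiff (s := S) hfm, mul_add]
    exact add_le_add
      (mul_measureReal_le_prod_one hη hη01 hcond (hS.inter hfm) fun x hx => hx.1.1)
      (mul_measureReal_le_prod_neg_one hlabel hη hη01 hcond (hS.diff hfm) fun x hx => hx.1.2)
  calc ENNReal.ofReal (ε * (P.map Prod.fst).real S * ℓ ρ)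
      ≤ ENNReal.ofReal (ℓ ρ * P.real T) :=
        ENNReal.ofReal_le_ofReal (by nlinarith [hnonneg ρ])
    _ = ENNReal.ofReal (ℓ ρ) * P T := by
        rw [ENNReal.ofReal_mul (hnonneg ρ), ofReal_measureReal]
    _ = ∫⁻ _ in T, ENNReal.ofReal (ℓ ρ) ∂P := (setLIntegral_const _ _).symm
    _ ≤ ∫⁻ p in T, ENNReal.ofReal (ℓ (ρ - p.2 * f p.1)) ∂P := by
        refine setLIntegral_mono' hT fun p hp => ENNReal.ofReal_le_ofReal (hmono ?_)
        rcases hp with ⟨⟨-, h1⟩, h2⟩ | ⟨⟨-, h1⟩, h2⟩ <;>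
          rw [Set.mem_singleton_iff] at h2 <;> rw [Set.mem_ofPred_eq] at h1 <;> rw [h2] <;>
          linarith
    _ ≤ _ := setLIntegral_le_lintegral _ _

end LabelledData

theorem stmt7 {X : Type*} [MeasurableSpace X]
    (P : Measure (X × ℝ)) [IsProbabilityMeasure P]
    (hlabel : ∀ᵐ p ∂P, p.2 = 1 ∨ p.2 = -1)
    (PX : Measure X) (hPX : PX = P.map Prod.fst)
    (η : X → ℝ) (hη_meas : Measurable η) (hη01 : ∀ x, η x ∈ Set.Icc (0:ℝ) 1)
    (hcond : ∀ A : Set X, MeasurableSet A →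
      P (A ×ˢ ({1} : Set ℝ)) = ENNReal.ofReal (∫ x in A, η x ∂PX))
    (ε : ℝ) (hε : 0 < ε)
    (hnd : 0 < PX {x | ε ≤ η x ∧ η x ≤ 1 - ε})
    (ℓ : ℝ → ℝ) (hconv : ConvexOn ℝ Set.univ ℓ) (hmono : Monotone ℓ)
    (hnonneg : ∀ z, 0 ≤ ℓ z) (hsub : SubdiffTendstoInfty ℓ) :
    ⊥ < ⨅ (f : X → ℝ) (_ : Measurable f) (ρ : ℝ),
      (((-2 * ρ : ℝ) : EReal)
        + ((∫⁻ p, ENNReal.ofReal (ℓ (ρ - p.2 * f p.1)) ∂P : ℝ≥0∞) : EReal)) := by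
  subst hPX
  have := Measure.isProbabilityMeasure_map (μ := P) measurable_fst.aemeasurable
  obtain ⟨b, hb⟩ := exists_forall_le_neg_two_mul_add hconv hnonneg hsub
    (mul_pos hε (ENNReal.toReal_pos hnd.ne' (measure_ne_top _ _)))
  refine (EReal.bot_lt_coe b).trans_le (le_iInf fun f => le_iInf fun hf => le_iInf fun ρ => ?_)
  have h := ofReal_mul_le_lintegral_loss (ε := ε) hlabel hη_meas hη01 hcond hmono hnonneg hf ρ
  refine le_trans ?_ (add_le_add le_rfl (EReal.coe_ennreal_le_coe_ennreal_iff.2 h))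
  rw [EReal.coe_ennreal_ofReal, ← EReal.coe_add, EReal.coe_le_coe_iff]
  exact (hb ρ).trans (add_le_add le_rfl (le_max_left _ _))
end

section
/- Let ℓ : ℝ → ℝ be a convex, non-decreasing, nonnegative function that is differentiable on [−ℓ(0)/2, ∞) with ℓ'(z) > 0 for z ≥ −ℓ(0)/2, and suppose d := sup{z ∈ ℝ : ∂ℓ(z) = {0}} satisfies d < −ℓ(0)/2 (with d = −∞ if no such z exists). For ρ ≥ −ℓ(0)/2 and z ≥ 0 define ξ(z, ρ) = (ℓ(ρ+z) + ℓ(ρ−z) − 2ℓ(ρ)) / (z ℓ'(ρ)) for z > 0 and ξ(0, ρ) = 0. Suppose there exists a function ξ̄ : [0,∞) → ℝ that is continuous and strictly increasing with ξ̄(0) = 0 and lim_{z→∞} ξ̄(z) > 1, and such that sup_{ρ ≥ −ℓ(0)/2} ξ(z, ρ) ≤ ξ̄(z) for every z ≥ 0. Then there exist ε > 0 and a function ψ̃ : [0, ε] → ℝ such that: ψ̃(0) = 0; ψ̃(θ) > 0 for 0 < θ ≤ ε; ψ̃ is continuous and strictly increasing on [0, ε]; and ψ̃(θ) ≤ inf_{ρ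 ≥ −ℓ(0)/2} ψ(θ, ρ) for all θ ∈ [0, ε], where ψ(θ, ρ) = ℓ(ρ) − inf_{z∈ℝ} [ ((1+θ)/2) ℓ(ρ − z) + ((1−θ)/2) ℓ(ρ + z) ]. -/
/-- A continuous strictly increasing function on `[0, ∞)` vanishing at `0` is dominated there by an
increasing homeomorphism of the line fixing `0`. -/
theorem exists_orderIso_ge_of_strictMonoOn_Ici {f : ℝ → ℝ} (hf : ContinuousOn f (Set.Ici 0))
    (hmono : StrictMonoOn f (Set.Ici 0)) (hzero : f 0 = 0) :
    ∃ e : ℝ ≃o ℝ, e 0 = 0 ∧ ∀ x, 0 ≤ x → f x ≤ e x := by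
  let g : ℝ → ℝ := fun x => f (max x 0) + x
  have hg : Continuous g := by
    refine Continuous.add ?_ continuous_id
    exact hf.comp_continuous (by fun_prop) fun x => le_max_right x 0
  have hg_mono : StrictMono g := by
    intro x y hxy
    have h : f (max x 0) ≤ f (max y 0) :=
      hmono.monotoneOn (le_max_right x 0) (le_max_right y 0) (max_le_max_right 0 hxy.le)
    exact add_lt_add_of_le_of_lt h hxy
  have hg_top : Filter.Tendsto g Filter.atTop Filter.atTop := by
    refine Filter.tendsto_atTop_mono (fun x => ?_) Filter.tendsto_id
    have h : f 0 ≤ f (max x 0) :=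
      hmono.monotoneOn Set.self_mem_Ici (le_max_right x 0) (le_max_right x 0)
    simp only [id, g]
    linarith
  have hg_bot : Filter.Tendsto g Filter.atBot Filter.atBot := by
    refine Filter.Tendsto.congr' ?_ Filter.tendsto_id
    filter_upwards [Filter.eventually_le_atBot 0] with x hx
    simp [g, max_eq_right hx, hzero]
  refine ⟨hg_mono.orderIsoOfSurjective g (hg.surjective hg_top hg_bot), ?_, fun x hx => ?_⟩
  · simp [g, hzero]
  · simp [g, hx]

theorem stmt11 (ℓ : ℝ → ℝ) (hconv : ConvexOn ℝ Set.univ ℓ) (hmono : Monotone ℓ)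
    (hnonneg : ∀ z, 0 ≤ ℓ z)
    (hdiff : ∀ z : ℝ, -ℓ 0 / 2 ≤ z → DifferentiableAt ℝ ℓ z)
    (hderiv_pos : ∀ z : ℝ, -ℓ 0 / 2 ≤ z → 0 < deriv ℓ z)
    -- `d := sup {z | ∂ℓ(z) = {0}} < -ℓ(0)/2` (with `d = -∞` if the set is empty):
    (d : ℝ) (hd : d < -ℓ 0 / 2)
    (hd_bound : ∀ z : ℝ, (∀ g : ℝ, IsSubgradientAt ℓ g z ↔ g = 0) → z ≤ d)
    (ξ : ℝ → ℝ → ℝ)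
    (hξ : ∀ z ρ : ℝ, ξ z ρ =
      if z = 0 then 0 else (ℓ (ρ + z) + ℓ (ρ - z) - 2 * ℓ ρ) / (z * deriv ℓ ρ))
    (ξbar : ℝ → ℝ)
    (hξbar_cont : ContinuousOn ξbar (Set.Ici (0:ℝ)))
    (hξbar_mono : StrictMonoOn ξbar (Set.Ici (0:ℝ)))
    (hξbar_zero : ξbar 0 = 0)
    (hξbar_lim : ∃ c : ℝ, 1 < c ∧ ∀ᶠ z in Filter.atTop, c ≤ ξbar z)
    (hξ_le : ∀ z : ℝ, 0 ≤ z → ∀ ρ : ℝ, -ℓ 0 / 2 ≤ ρ → ξ z ρ ≤ ξbar z)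
    (ψ : ℝ → ℝ → ℝ)
    (hψ : ∀ θ ρ, ψ θ ρ = ℓ ρ -
      sInf {v : ℝ | ∃ z : ℝ, v = (1 + θ)/2 * ℓ (ρ - z) + (1 - θ)/2 * ℓ (ρ + z)}) :
    ∃ ε : ℝ, 0 < ε ∧ ∃ ψt : ℝ → ℝ,
      ψt 0 = 0 ∧
      (∀ θ : ℝ, 0 < θ → θ ≤ ε → 0 < ψt θ) ∧
      ContinuousOn ψt (Set.Icc 0 ε) ∧
      StrictMonoOn ψt (Set.Icc 0 ε) ∧
      (∀ θ ∈ Set.Icc (0:ℝ) ε, ∀ ρ : ℝ, -ℓ 0 / 2 ≤ ρ → ψt θ ≤ ψ θ ρ) := by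
  obtain ⟨e, he_zero, he⟩ :=
    exists_orderIso_ge_of_strictMonoOn_Ici hξbar_cont hξbar_mono hξbar_zero
  have hs_zero : e.symm 0 = 0 := by rw [OrderIso.symm_apply_eq, he_zero]
  have hs_pos : ∀ {t : ℝ}, 0 < t → 0 < e.symm t := fun {t} ht => by
    simpa [hs_zero] using e.symm.strictMono ht
  set m : ℝ := deriv ℓ (-ℓ 0 / 2) with hm
  have hm_pos : 0 < m := hderiv_pos _ le_rfl
  refine ⟨1, one_pos, fun θ => m / 4 * (θ * e.symm (θ / 2)), by simp, ?_, ?_, ?_, ?_⟩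
  · intro θ hθ _
    have := hs_pos (half_pos hθ)
    positivity
  · have := e.symm.continuous
    exact Continuous.continuousOn (by fun_prop)
  · intro x hx y _ hxy
    have hy : 0 < y := hx.1.trans_lt hxy
    have hlt : e.symm (x / 2) < e.symm (y / 2) := e.symm.strictMono (by linarith)
    have := hs_pos (half_pos hy)
    exact mul_lt_mul_of_pos_left
      ((mul_le_mul_of_nonneg_left hlt.le hx.1).trans_lt (mul_lt_mul_of_pos_right hxy this))
      (by positivity)
  · rintro θ ⟨hθ0, hθ1⟩ ρ hρ
    set z := e.symm (θ / 2) with hz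
    have hez : e z = θ / 2 := by simp [hz]
    have hz_nonneg : 0 ≤ z := by
      simpa [hs_zero] using e.symm.monotone (by linarith : (0 : ℝ) ≤ θ / 2)
    have hρ_pos : 0 < deriv ℓ ρ := hderiv_pos ρ hρ
    have hmρ : m ≤ deriv ℓ ρ := by
      rcases hρ.eq_or_lt with h | h
      · rw [hm, h]
      · exact (hconv.deriv_le_slope (Set.mem_univ _) (Set.mem_univ _) h (hdiff _ le_rfl)).trans
          (hconv.slope_le_deriv (Set.mem_univ _) (Set.mem_univ _) h (hdiff _ hρ))
    have htangent : z * deriv ℓ ρ ≤ ℓ (ρ + z) - ℓ ρ := by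
      rcases hz_nonneg.eq_or_lt with h | h
      · simp [← h]
      · have := hconv.deriv_le_slope (Set.mem_univ ρ) (Set.mem_univ (ρ + z)) (by linarith)
          (hdiff _ hρ)
        rw [slope_def_field, add_sub_cancel_left, le_div_iff₀ h] at this
        linarith
    have hcurv : ℓ (ρ + z) + ℓ (ρ - z) - 2 * ℓ ρ ≤ θ / 2 * (z * deriv ℓ ρ) := by
      rcases hz_nonneg.eq_or_lt with h | h
      · simp only [← h, add_zero, sub_zero, zero_mul, mul_zero]
        linarith
      · have := ((hξ_le z hz_nonneg ρ hρ).trans (he z hz_nonneg)).trans_eq hez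
        rwa [hξ, if_neg h.ne', div_le_iff₀ (by positivity)] at this
    have hinf : sInf {v : ℝ | ∃ z : ℝ,
        v = (1 + θ) / 2 * ℓ (ρ - z) + (1 - θ) / 2 * ℓ (ρ + z)} ≤
        (1 + θ) / 2 * ℓ (ρ - z) + (1 - θ) / 2 * ℓ (ρ + z) := by
      refine csInf_le ⟨0, ?_⟩ ⟨z, rfl⟩
      rintro _ ⟨w, rfl⟩
      have h₁ := mul_nonneg (by linarith : 0 ≤ (1 + θ) / 2) (hnonneg (ρ - w))
      have h₂ := mul_nonneg (by linarith : 0 ≤ (1 - θ) / 2) (hnonneg (ρ + w))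
      exact add_nonneg h₁ h₂
    have hleft : ℓ (ρ - z) ≤ ℓ ρ := hmono (by linarith)
    have hdiff_ge : θ * (z * deriv ℓ ρ) ≤ θ * (ℓ (ρ + z) - ℓ (ρ - z)) :=
      mul_le_mul_of_nonneg_left (by linarith) hθ0
    have hm_le : θ * z * m ≤ θ * z * deriv ℓ ρ :=
      mul_le_mul_of_nonneg_left hmρ (mul_nonneg hθ0 hz_nonneg)
    rw [hψ]
    change m / 4 * (θ * z) ≤ _
    linarith
end

section
/- Let w > 0 and h ≥ 0. Define ℓ̄* : ℝ → ℝ ∪ {∞} by ℓ̄*(α) = (|αw − 1| + h)² − (1 + h)² for α ≥ 0 and ℓ̄*(α) = +∞ for α < 0, and define u : ℝ → ℝ by u(t) = 0 for t ≤ −2h−2; u(t) = (t/2 + 1 + h)² for −2h−2 ≤ t ≤ −2h; u(t) = t + 2h + 1 for −2h ≤ t ≤ 2h; and u(t) = t²/4 + t(1−h) + (1+h)² for t ≥ 2h. Then the convex conjugate of ℓ̄* is ℓ̄(z) = sup_{α∈ℝ}(αz − ℓ̄*(α)) = sup_{α ≥ 0}(αz − ((|αw − 1| + h)² − (1 + h)²))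 = u(z/w) for every z ∈ ℝ. -/
/-- The piecewise function `u` from Example 3 (uncertainty set with estimation error). -/
noncomputable def uFun (h : ℝ) (t : ℝ) : ℝ :=
  if t ≤ -2*h - 2 then 0
  else if t ≤ -2*h then (t/2 + 1 + h)^2
  else if t ≤ 2*h then t + 2*h + 1
  else t^2/4 + t*(1 - h) + (1 + h)^2

/-- Every `s ≥ 0` gives a lower bound for `uFun h t`, the conjugate with unit scale `w = 1`. -/
theorem le_uFun {h : ℝ} (hh : 0 ≤ h) (t : ℝ) {s : ℝ} (hs : 0 ≤ s) :
    s * t - ((|s - 1| + h)^2 - (1 + h)^2) ≤ uFun h t := by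
  unfold uFun
  rcases le_total s 1 with hs1 | hs1
  · rw [abs_of_nonpos (by linarith)]
    split_ifs with h1 h2 h3
    · nlinarith [mul_nonneg hs (sub_nonneg.2 h1), sq_nonneg s]
    · nlinarith [sq_nonneg (s - (t/2 + 1 + h))]
    · nlinarith [mul_nonneg (sub_nonneg.2 hs1) (sub_nonneg.2 (not_le.1 h2).le),
        sq_nonneg (s - 1)]
    · nlinarith [mul_nonneg (sub_nonneg.2 hs1) (sub_nonneg.2 (not_le.1 h3).le),
        mul_nonneg (sub_nonneg.2 hs1) hh, sq_nonneg (s - 1), sq_nonneg (t/2 - h)]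
  · rw [abs_of_nonneg (by linarith)]
    split_ifs with h1 h2 h3
    · nlinarith [mul_nonneg hs (sub_nonneg.2 h1), sq_nonneg s,
        mul_nonneg (sub_nonneg.2 hs1) hh]
    · nlinarith [mul_nonneg (sub_nonneg.2 hs1) (sub_nonneg.2 h2),
        mul_nonneg (sub_nonneg.2 hs1) hh, sq_nonneg (s - 1), sq_nonneg (t/2 + h)]
    · nlinarith [mul_nonneg (sub_nonneg.2 hs1) (sub_nonneg.2 h3), sq_nonneg (s - 1)]
    · nlinarith [sq_nonneg (s - (t/2 + 1 - h))]

/-- The value `uFun h t` is attained at some `s ≥ 0`. -/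
theorem exists_eq_uFun (h t : ℝ) :
    ∃ s : ℝ, 0 ≤ s ∧ s * t - ((|s - 1| + h)^2 - (1 + h)^2) = uFun h t := by
  unfold uFun
  split_ifs with h1 h2 h3
  · exact ⟨0, le_rfl, by simp⟩
  · refine ⟨t/2 + 1 + h, by linarith, ?_⟩
    rw [abs_of_nonpos (by linarith)]
    ring
  · refine ⟨1, zero_le_one, ?_⟩
    rw [sub_self, abs_zero]
    ring
  · refine ⟨t/2 + 1 - h, by linarith, ?_⟩
    rw [abs_of_nonneg (by linarith)]
    ring

theorem stmt17 (w h : ℝ) (hw : 0 < w) (hh : 0 ≤ h)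
    (lbar : ℝ → EReal)
    (hlbar : ∀ a : ℝ, lbar a =
      if 0 ≤ a then (((|a * w - 1| + h)^2 - (1 + h)^2 : ℝ) : EReal) else ⊤)
    (z : ℝ) :
    (⨆ a : ℝ, (((a * z : ℝ) : EReal) - lbar a)) = ((uFun h (z / w) : ℝ) : EReal) ∧
    (⨆ a : {a : ℝ // 0 ≤ a},
        ((a.1 * z - ((|a.1 * w - 1| + h)^2 - (1 + h)^2) : ℝ) : EReal))
      = ((uFun h (z / w) : ℝ) : EReal) := by
  have key : (⨆ a : {a : ℝ // 0 ≤ a},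
      ((a.1 * z - ((|a.1 * w - 1| + h)^2 - (1 + h)^2) : ℝ) : EReal))
        = ((uFun h (z / w) : ℝ) : EReal) := by
    have hz : ∀ a : ℝ, a * w * (z / w) = a * z := fun a => by field_simp
    apply le_antisymm
    · refine iSup_le fun a => EReal.coe_le_coe_iff.2 ?_
      rw [← hz]
      exact le_uFun hh _ (mul_nonneg a.2 hw.le)
    · obtain ⟨s, hs, hs_eq⟩ := exists_eq_uFun h (z / w)
      refine le_iSup_of_le ⟨s / w, div_nonneg hs hw.le⟩ (EReal.coe_le_coe_iff.2 ?_)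
      rw [← hz, div_mul_cancel₀ s hw.ne', hs_eq]
  refine ⟨?_, key⟩
  rw [← key]
  apply le_antisymm
  · refine iSup_le fun a => ?_
    rw [hlbar]
    split_ifs with ha
    · rw [← EReal.coe_sub]
      exact le_iSup (fun a : {a : ℝ // 0 ≤ a} =>
        ((a.1 * z - ((|a.1 * w - 1| + h)^2 - (1 + h)^2) : ℝ) : EReal)) ⟨a, ha⟩
    · rw [EReal.sub_top]
      exact bot_le
  · refine iSup_le fun a => le_iSup_of_le a.1 ?_
    rw [hlbar, if_pos a.2, ← EReal.coe_sub]
end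

section
/- Let w > 1/2 and h ≥ 0. Define u : ℝ → ℝ by u(t) = 0 for t ≤ −2h−2; u(t) = (t/2 + 1 + h)² for −2h−2 ≤ t ≤ −2h; u(t) = t + 2h + 1 for −2h ≤ t ≤ 2h; and u(t) = t²/4 + t(1−h) + (1+h)² for t ≥ 2h, and set ℓ̄(z) = u(z/w), so that ℓ̄(0) = 2h + 1. Define ψ(θ, ρ) = ℓ̄(ρ) − inf_{z∈ℝ} [ ((1+θ)/2) ℓ̄(ρ − z) + ((1−θ)/2) ℓ̄(ρ + z) ]. Then for every θ ∈ [0, 1) and every ρ ≥ −ℓ̄(0)/2 = −(2h+1)/2, the inequality ψ(θ, ρ) ≥ ((4w − 1)/(32 w²)) · θ² holds. -/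
theorem uFun_nonneg {h : ℝ} (hh : 0 ≤ h) (t : ℝ) : 0 ≤ uFun h t := by
  unfold uFun
  split_ifs
  · exact le_rfl
  · positivity
  · linarith
  · nlinarith [sq_nonneg (t/2 + 1 - h)]

/-- Above `-2h-2`, the function `uFun h` has a quadratic majorant of curvature `1/2` touching it at
`t`, whose slope at `t` is either at least `1` or equal to `t/2 + 1 + h`. -/
theorem exists_uFun_le_quadratic {h : ℝ} (hh : 0 ≤ h) {t : ℝ} (ht : -2*h - 2 < t) :
    ∃ d : ℝ, (1 ≤ d ∨ d = t/2 + 1 + h) ∧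
      ∀ y, uFun h y ≤ uFun h t + d * (y - t) + (y - t)^2/4 := by
  rcases le_or_gt t (-2*h) with h₂ | h₂
  · refine ⟨t/2 + 1 + h, Or.inr rfl, fun y => ?_⟩
    rw [show uFun h t = (t/2 + 1 + h)^2 by simp only [uFun, if_neg ht.not_ge, if_pos h₂]]
    unfold uFun
    split_ifs
    · nlinarith [sq_nonneg (y/2 + 1 + h)]
    · nlinarith
    · nlinarith [sq_nonneg (y/2 + h)]
    · nlinarith [mul_nonneg hh (show 0 ≤ y by linarith)]
  rcases le_or_gt t (2*h) with h₃ | h₃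
  · refine ⟨1, Or.inl le_rfl, fun y => ?_⟩
    rw [show uFun h t = t + 2*h + 1 by
      simp only [uFun, if_neg ht.not_ge, if_neg h₂.not_ge, if_pos h₃]]
    unfold uFun
    split_ifs
    · nlinarith [sq_nonneg (y/2 + h + 1),
        mul_nonneg (show 0 ≤ t + 2*h by linarith) (show 0 ≤ t - y + (-2*h - y) by linarith)]
    · nlinarith [
        mul_nonneg (show 0 ≤ t + 2*h by linarith) (show 0 ≤ t - y + (-2*h - y) by linarith)]
    · nlinarith [sq_nonneg (y - t)]
    · nlinarith [
        mul_nonneg (show 0 ≤ 2*h - t by linarith) (show 0 ≤ y - t + (y - 2*h) by linarith)]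
  · refine ⟨t/2 + 1 - h, Or.inl (by linarith), fun y => ?_⟩
    rw [show uFun h t = t^2/4 + t*(1 - h) + (1 + h)^2 by
      simp only [uFun, if_neg ht.not_ge, if_neg h₂.not_ge, if_neg h₃.not_ge]]
    unfold uFun
    split_ifs
    · nlinarith [sq_nonneg (y/2 + 1 - h)]
    · nlinarith [mul_nonneg hh (show 0 ≤ -y by linarith)]
    · nlinarith [sq_nonneg (y/2 - h)]
    · nlinarith

theorem stmt18 (w h : ℝ) (hw : 1/2 < w) (hh : 0 ≤ h)
    (lbar : ℝ → ℝ) (hlbar : ∀ z : ℝ, lbar z = uFun h (z / w))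
    (ψ : ℝ → ℝ → ℝ)
    (hψ : ∀ θ ρ, ψ θ ρ = lbar ρ -
      sInf {v : ℝ | ∃ z : ℝ, v = (1 + θ)/2 * lbar (ρ - z) + (1 - θ)/2 * lbar (ρ + z)})
    (θ ρ : ℝ) (hθ0 : 0 ≤ θ) (hθ1 : θ < 1) (hρ : -(2*h + 1)/2 ≤ ρ) :
    (4*w - 1)/(32*w^2) * θ^2 ≤ ψ θ ρ := by
  have hw0 : 0 < w := by linarith
  obtain ⟨g, hg⟩ : ∃ g, g = (4*w - 1)/(4*w) := ⟨_, rfl⟩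
  have hgw : g * (4*w) = 4*w - 1 := by rw [hg]; field_simp
  have hg_pos : 0 < g := by rw [hg]; exact div_pos (by linarith) (by linarith)
  have hg_half : 1/2 ≤ g := by rw [hg, le_div_iff₀ (by linarith)]; linarith
  have hg_one : g ≤ 1 := by rw [hg, div_le_one (by linarith)]; linarith
  have ht : -(2*h + 1) * (1 - g) * 2 ≤ ρ / w := by
    rw [le_div_iff₀ hw0]
    nlinarith
  have htlow : -2*h - 2 < ρ / w := by nlinarith
  obtain ⟨d, hd, hquad⟩ := exists_uFun_le_quadratic hh htlow
  have hgd : g ≤ d := by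
    rcases hd with hd | hd
    · linarith
    · nlinarith
  have hbdd : BddBelow {v : ℝ | ∃ z : ℝ,
      v = (1 + θ)/2 * lbar (ρ - z) + (1 - θ)/2 * lbar (ρ + z)} := by
    refine ⟨0, ?_⟩
    rintro v ⟨z, rfl⟩
    rw [hlbar, hlbar]
    exact add_nonneg (mul_nonneg (by linarith) (uFun_nonneg hh _))
      (mul_nonneg (by linarith) (uFun_nonneg hh _))
  have hinf := csInf_le hbdd ⟨w * (2*θ*g), rfl⟩
  rw [hlbar, hlbar,
    show (ρ - w * (2*θ*g)) / w = ρ / w - 2*θ*g by field_simp,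
    show (ρ + w * (2*θ*g)) / w = ρ / w + 2*θ*g by field_simp] at hinf
  have hminus := mul_le_mul_of_nonneg_left (hquad (ρ / w - 2*θ*g))
    (show 0 ≤ (1 + θ)/2 by linarith)
  have hplus := mul_le_mul_of_nonneg_left (hquad (ρ / w + 2*θ*g))
    (show 0 ≤ (1 - θ)/2 by linarith)
  have hconst : (4*w - 1)/(32*w^2) ≤ g^2 := by
    rw [div_le_iff₀ (by positivity)]
    have : g^2 * (32*w^2) = 2 * (4*w - 1)^2 := by rw [← hgw]; ring
    nlinarith
  have hslope : 0 ≤ θ^2 * g * (d - g) :=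
    mul_nonneg (mul_nonneg (sq_nonneg θ) hg_pos.le) (by linarith)
  rw [hψ, hlbar ρ]
  calc (4*w - 1)/(32*w^2) * θ^2 ≤ g^2 * θ^2 := mul_le_mul_of_nonneg_right hconst (sq_nonneg θ)
    _ ≤ _ := by linarith
end

section
/- Let ℓ(z) = e^z and define ψ(θ, ρ) = ℓ(ρ) − inf_{z∈ℝ} [ ((1+θ)/2) ℓ(ρ − z) + ((1−θ)/2) ℓ(ρ + z) ]. Then for every θ ∈ [0, 1] and every ρ ∈ ℝ, ψ(θ, ρ) = (1 − √(1 − θ²)) · e^ρ. -/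
theorem isGLB_exp_conditional_risk (θ ρ : ℝ) (hθ : θ ∈ Set.Icc (0:ℝ) 1) :
    IsGLB {v : ℝ | ∃ z : ℝ,
        v = (1 + θ)/2 * Real.exp (ρ - z) + (1 - θ)/2 * Real.exp (ρ + z)}
      (Real.sqrt (1 - θ^2) * Real.exp ρ) := by
  obtain ⟨h0, h1⟩ := hθ
  have hs : Real.sqrt (1 - θ^2) ^ 2 = 1 - θ^2 := Real.sq_sqrt (by nlinarith)
  constructor
  · rintro v ⟨z, rfl⟩
    have hX : 0 ≤ (1 + θ)/2 * Real.exp (ρ - z) := by positivity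
    have hY : 0 ≤ (1 - θ)/2 * Real.exp (ρ + z) :=
      mul_nonneg (by linarith) (Real.exp_pos _).le
    have hE : Real.exp (ρ - z) * Real.exp (ρ + z) = Real.exp ρ ^ 2 := by
      rw [← Real.exp_add, sq, ← Real.exp_add]
      ring_nf
    refine le_of_sq_le_sq ?_ (add_nonneg hX hY)
    calc (Real.sqrt (1 - θ^2) * Real.exp ρ) ^ 2
        = 4 * ((1 + θ)/2 * Real.exp (ρ - z)) * ((1 - θ)/2 * Real.exp (ρ + z)) := by
          rw [mul_pow, hs, ← hE]
          ring
      _ ≤ _ := four_mul_le_sq_add _ _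
  · intro b hb
    rcases h1.lt_or_eq with h1 | rfl
    · have hpos : 0 < Real.sqrt (1 - θ^2) := Real.sqrt_pos.2 (by nlinarith)
      refine hb ⟨Real.log ((1 + θ) / Real.sqrt (1 - θ^2)), ?_⟩
      rw [Real.exp_sub, Real.exp_add, Real.exp_log (by positivity)]
      field_simp
      linear_combination hs
    · refine le_of_forall_pos_le_add fun ε hε => hb ⟨ρ - Real.log ε, ?_⟩
      simp [Real.exp_log hε]

theorem stmt19 (ψ : ℝ → ℝ → ℝ)
    (hψ : ∀ θ ρ, ψ θ ρ = Real.exp ρ -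
      sInf {v : ℝ | ∃ z : ℝ,
        v = (1 + θ)/2 * Real.exp (ρ - z) + (1 - θ)/2 * Real.exp (ρ + z)})
    (θ ρ : ℝ) (hθ : θ ∈ Set.Icc (0:ℝ) 1) :
    ψ θ ρ = (1 - Real.sqrt (1 - θ^2)) * Real.exp ρ := by
  rw [hψ, (isGLB_exp_conditional_risk θ ρ hθ).csInf_eq ⟨_, 0, rfl⟩]
  ring
end
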